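/- Let φ, ψ : S¹ → ℝ be C¹, d̄ = d_{S¹}(φ,ψ) > 0, and ρ_ᾱ an optimal rotation. Let Θ = {θ ∈ S¹ : |φ(θ) − ψ(θ+ᾱ)| = d̄}. If no point (θ, ᾱ) with θ ∈ Θ is a critical point of F(θ,α) = |φ(θ) − ψ(θ+α)|, then there exist θ̄₁, θ̄₂ ∈ Θ such that ∂F/∂α(θ̄₁,ᾱ) · ∂F/∂α(θ̄₂,ᾱ) < 0. -/

import Mathlib

open Filter Topology Set

/-- Pointwise comparison function F(θ,α) = |φ(θ) − ψ(θ+α)|. -/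
noncomputable def nF (φ ψ : ℝ → ℝ) (θ α : ℝ) : ℝ := |φ θ - ψ (θ + α)|

/-- g(α) = max over θ of F(θ,α), as a supremum. -/
noncomputable def nG (φ ψ : ℝ → ℝ) (α : ℝ) : ℝ := ⨆ θ : ℝ, nF φ ψ θ α

/-- Natural pseudo-distance associated with the rotation group S¹. -/
noncomputable def nD (φ ψ : ℝ → ℝ) : ℝ := ⨅ α : ℝ, nG φ ψ α

/-- A Morse function on S¹ (as a 2π-periodic function on ℝ). -/
def IsMorse (φ : ℝ → ℝ) : Prop :=
  ContDiff ℝ (⊤ : ℕ∞) φ ∧ ∀ θ : ℝ, deriv φ θ = 0 → deriv (deriv φ) θ ≠ 0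

/-- If the slices `H θ` are at most `c` at `0`, with positive derivative wherever equality holds,
then over a compact set of parameters they all drop below `c` at a common negative time. -/
lemma exists_neg_forall_lt_of_deriv_pos {H H' : ℝ → ℝ → ℝ} {K : Set ℝ} {c : ℝ}
    (hK : IsCompact K) (hH : Continuous (Function.uncurry H))
    (hH' : Continuous (Function.uncurry H'))
    (hderiv : ∀ θ u, HasDerivAt (H θ) (H' θ u) u)
    (hle : ∀ θ ∈ K, H θ 0 ≤ c) (hpos : ∀ θ ∈ K, H θ 0 = c → 0 < H' θ 0) :
    ∃ u < 0, ∀ θ ∈ K, H θ u < c := by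
  have hopen : IsOpen {p : ℝ × ℝ | Function.uncurry H p < c ∨ 0 < Function.uncurry H' p} :=
    (isOpen_lt hH continuous_const).union (isOpen_lt continuous_const hH')
  have hsub : K ×ˢ {(0 : ℝ)} ⊆
      {p : ℝ × ℝ | Function.uncurry H p < c ∨ 0 < Function.uncurry H' p} := by
    rintro ⟨θ, u⟩ ⟨hθ, hu⟩
    obtain rfl : u = 0 := hu
    exact (hle θ hθ).lt_or_eq.imp id (hpos θ hθ)
  obtain ⟨U, V, -, hV, hKU, h0V, hUV⟩ := generalized_tube_lemma hK isCompact_singleton hopen hsub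
  obtain ⟨r, hr, hrV⟩ := Metric.isOpen_iff.1 hV 0 (h0V rfl)
  refine ⟨-(r / 2), by linarith, fun θ hθ => ?_⟩
  by_contra! hc
  have hno : ∀ s, -(r / 2) ≤ s → s < 0 → c ≤ H θ s →
      ¬ IsMaxOn (H θ) (Icc (-(r / 2)) 0) s := by
    intro s hs hs0 hcs hmax
    have hd : 0 < H' θ s := by
      have hsV : s ∈ V := hrV (by
        rw [Metric.mem_ball, Real.dist_eq, abs_lt]; constructor <;> linarith)
      exact (hUV (mk_mem_prod (hKU hθ) hsV)).resolve_left (not_lt.2 hcs)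
    have hlim := (hderiv θ s).tendsto_slope.mono_left
      (nhdsWithin_mono s (s := Ioi s) (fun x hx => ne_of_gt hx))
    obtain ⟨x, hx, hx0⟩ := ((hlim.eventually (lt_mem_nhds hd)).and
      (Ioo_mem_nhdsGT hs0)).exists
    have hxs : H θ x ≤ H θ s := hmax ⟨hs.trans hx0.1.le, hx0.2.le⟩
    rw [slope_def_field] at hx
    exact absurd hx (not_lt.2
      (div_nonpos_of_nonpos_of_nonneg (by linarith) (by linarith [hx0.1])))
  have hcont : Continuous (H θ) := hH.comp (Continuous.prodMk_right θ)
  obtain ⟨s, hs, hmax⟩ := isCompact_Icc.exists_isMaxOn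
    (nonempty_Icc.2 (by linarith : -(r / 2) ≤ 0)) hcont.continuousOn
  have hends : H θ (-(r / 2)) ≤ H θ s := hmax (left_mem_Icc.2 (by linarith))
  rcases hs.2.lt_or_eq with hs0 | rfl
  · exact hno s hs.1 hs0 (hc.trans hends) hmax
  · exact hno (-(r / 2)) le_rfl (by linarith) hc
      fun x hx => (hmax hx).trans ((hle θ hθ).trans hc)

lemma exists_forall_nF_le {φ ψ : ℝ → ℝ} (hφ : Continuous φ) (hψ : Continuous ψ)
    (hpφ : Function.Periodic φ (2 * Real.pi)) (hpψ : Function.Periodic ψ (2 * Real.pi)) (α : ℝ) :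
    ∃ θ ∈ Icc 0 (2 * Real.pi), ∀ t, nF φ ψ t α ≤ nF φ ψ θ α := by
  have hcont : Continuous fun t => nF φ ψ t α := by unfold nF; fun_prop
  have hper : Function.Periodic (fun t => nF φ ψ t α) (2 * Real.pi) := fun t => by
    simp only [nF, hpφ t, add_right_comm t _ α, hpψ (t + α)]
  obtain ⟨θ, hθ, hmax⟩ := isCompact_Icc.exists_isMaxOn
    (nonempty_Icc.2 Real.two_pi_pos.le) hcont.continuousOn
  refine ⟨θ, hθ, fun t => ?_⟩
  obtain ⟨y, hy, hty⟩ := hper.exists_mem_Ico₀ Real.two_pi_pos t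
  exact hty.le.trans (hmax ⟨hy.1, hy.2.le⟩)

lemma nD_le_nG (φ ψ : ℝ → ℝ) (α : ℝ) : nD φ ψ ≤ nG φ ψ α :=
  ciInf_le ⟨0, by rintro _ ⟨a, rfl⟩; exact Real.iSup_nonneg fun t => abs_nonneg _⟩ α

theorem opposite_partial_signs (φ ψ : ℝ → ℝ)
    (hφ : ContDiff ℝ 1 φ) (hψ : ContDiff ℝ 1 ψ)
    (hpφ : Function.Periodic φ (2 * Real.pi)) (hpψ : Function.Periodic ψ (2 * Real.pi))
    (α' : ℝ) (hopt : nG φ ψ α' = nD φ ψ) (hd : 0 < nD φ ψ)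
    (hnc : ∀ θ : ℝ, nF φ ψ θ α' = nD φ ψ →
      ¬ (deriv (fun t => nF φ ψ t α') θ = 0 ∧ deriv (fun a => nF φ ψ θ a) α' = 0)) :
    ∃ θ₁ θ₂ : ℝ, nF φ ψ θ₁ α' = nD φ ψ ∧ nF φ ψ θ₂ α' = nD φ ψ ∧
      deriv (fun a => nF φ ψ θ₁ a) α' * deriv (fun a => nF φ ψ θ₂ a) α' < 0 := by
  have hcφ := hφ.continuous
  have hcψ := hψ.continuous
  have hcψ' : Continuous (deriv ψ) := hψ.continuous_deriv le_rfl
  have hle : ∀ t, nF φ ψ t α' ≤ nD φ ψ := fun t => by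
    obtain ⟨θ, -, hθ⟩ := exists_forall_nF_le hcφ hcψ hpφ hpψ α'
    exact hopt ▸ le_ciSup (f := fun t => nF φ ψ t α')
      ⟨nF φ ψ θ α', by rintro _ ⟨s, rfl⟩; exact hθ s⟩ t
  have hattain : ∀ α, ∃ θ ∈ Icc 0 (2 * Real.pi), nD φ ψ ≤ nF φ ψ θ α := fun α => by
    obtain ⟨θ, hθK, hθ⟩ := exists_forall_nF_le hcφ hcψ hpφ hpψ α
    exact ⟨θ, hθK, (nD_le_nG φ ψ α).trans (ciSup_le hθ)⟩
  have hsq : ∀ θ α, (φ θ - ψ (θ + α)) ^ 2 = nF φ ψ θ α ^ 2 := fun θ α => (sq_abs _).symm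
  have hdiff : ∀ θ α,
      HasDerivAt (fun a => (φ θ - ψ (θ + a)) ^ 2)
        (2 * (-(φ θ - ψ (θ + α)) * deriv ψ (θ + α))) α := fun θ α => by
    have h1 : HasDerivAt (fun a => ψ (θ + a)) (deriv ψ (θ + α)) α :=
      ((hψ.differentiable one_ne_zero (θ + α)).hasDerivAt).comp_const_add θ α
    refine ((h1.const_sub (φ θ)).fun_pow 2).congr_deriv ?_
    push_cast
    ring
  have hderiv : ∀ θ, nF φ ψ θ α' = nD φ ψ → deriv (fun a => nF φ ψ θ a) α' * nD φ ψ =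
      -(φ θ - ψ (θ + α')) * deriv ψ (θ + α') := fun θ hθ => by
    have hsqrt : (fun a => nF φ ψ θ a) = fun a => √((φ θ - ψ (θ + a)) ^ 2) :=
      funext fun a => (Real.sqrt_sq_eq_abs _).symm
    have hne : (φ θ - ψ (θ + α')) ^ 2 ≠ 0 := by rw [hsq, hθ]; positivity
    rw [hsqrt, ((hdiff θ α').sqrt hne).deriv, hsq, hθ, Real.sqrt_sq hd.le]
    field_simp
  have hne : ∀ θ, nF φ ψ θ α' = nD φ ψ → deriv (fun a => nF φ ψ θ a) α' ≠ 0 := fun θ hθ h =>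
    hnc θ hθ ⟨IsLocalMax.deriv_eq_zero (Eventually.of_forall fun t => (hle t).trans hθ.ge), h⟩
  have key : ∀ σ : ℝ, ∃ θ, nF φ ψ θ α' = nD φ ψ ∧
      σ * deriv (fun a => nF φ ψ θ a) α' ≤ 0 := fun σ => by
    by_contra! hall
    obtain ⟨u, -, hu⟩ := exists_neg_forall_lt_of_deriv_pos
      (H := fun θ u => (φ θ - ψ (θ + (α' + σ * u))) ^ 2)
      (H' := fun θ u => 2 * (-(φ θ - ψ (θ + (α' + σ * u))) * deriv ψ (θ + (α' + σ * u))) * σ)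
      (K := Icc 0 (2 * Real.pi)) (c := nD φ ψ ^ 2) isCompact_Icc
      (by unfold Function.uncurry; fun_prop) (by unfold Function.uncurry; fun_prop)
      (fun θ u => by
        have h1 : HasDerivAt (fun u => α' + σ * u) σ u := by
          simpa using ((hasDerivAt_id u).const_mul σ).const_add α'
        exact (hdiff θ (α' + σ * u)).comp u h1)
      (fun θ _ => by
        simp only [mul_zero, add_zero, hsq]
        exact pow_le_pow_left₀ (abs_nonneg _) (hle θ) 2)
      (fun θ _ h => by
        simp only [mul_zero, add_zero, hsq] at h ⊢
        have hθ := (sq_eq_sq₀ (abs_nonneg _) hd.le).1 h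
        rw [← hderiv θ hθ]
        nlinarith [mul_pos (hall θ hθ) hd])
    obtain ⟨θ, hθK, hθ⟩ := hattain (α' + σ * u)
    have := hu θ hθK
    rw [hsq] at this
    exact absurd (pow_le_pow_left₀ hd.le hθ 2) (not_le.2 this)
  obtain ⟨θ₁, h₁, hs₁⟩ := key 1
  obtain ⟨θ₂, h₂, hs₂⟩ := key (-1)
  have hneg := lt_of_le_of_ne (by linarith) (hne θ₁ h₁)
  have hpos := lt_of_le_of_ne (by linarith) (hne θ₂ h₂).symm
  exact ⟨θ₁, θ₂, h₁, h₂, mul_neg_of_neg_of_pos hneg hpos⟩
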